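/- (Theorem 3.3.) Assume (X,d) is a proper, geodesic, non-branching complete separable metric space, the Borel measure m satisfies the evolution estimate with rate f, and the restriction of m to the compact set K is a doubling measure. Let μ₀,μ₁ be Borel probability measures with supp(μ₀),supp(μ₁)⊂K and μ₀≪m. Then for every coupling π∈Π(μ₀,μ₁) with π(Γ)=1 there exists an m-measurable map T:X→X such that π(graph(T))=1, i.e. π=(id,T)_♯μ₀. -/

import Mathlib

open Set Metric MeasureTheory

/-- A geodesic parametrized on `[0,1]`: `d(γ_s,γ_t) = |s-t| · d(γ_0,γ_1)`. -/
def IsGeodesic {X : Type*} [MetricSpace X] (γ : ℝ → X) : Prop :=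
  ∀ s ∈ Set.Icc (0:ℝ) 1, ∀ t ∈ Set.Icc (0:ℝ) 1,
    dist (γ s) (γ t) = |s - t| * dist (γ 0) (γ 1)

/-- A geodesic metric space: every pair of points is joined by a geodesic. -/
def GeodesicMetricSpace (X : Type*) [MetricSpace X] : Prop :=
  ∀ x y : X, ∃ γ : ℝ → X, IsGeodesic γ ∧ γ 0 = x ∧ γ 1 = y

/-- Non-branching: two geodesics agreeing on `[0,t]` for some `t ∈ (0,1)` agree on `[0,1]`. -/
def NonBranching (X : Type*) [MetricSpace X] : Prop :=
  ∀ γ₁ γ₂ : ℝ → X, IsGeodesic γ₁ → IsGeodesic γ₂ →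
    ∀ t ∈ Set.Ioo (0:ℝ) 1, (∀ s ∈ Set.Icc (0:ℝ) t, γ₁ s = γ₂ s) →
      ∀ s ∈ Set.Icc (0:ℝ) 1, γ₁ s = γ₂ s

/-- The evolution set `A_{t,Λ} = {γ_t : γ geodesic, γ_0 ∈ A, (γ_0,γ_1) ∈ Λ}`. -/
def evoSet {X : Type*} [MetricSpace X] (A : Set X) (Λ : Set (X × X)) (t : ℝ) : Set X :=
  {z | ∃ γ : ℝ → X, IsGeodesic γ ∧ γ 0 ∈ A ∧ (γ 0, γ 1) ∈ Λ ∧ γ t = z}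

/-- `m` satisfies the evolution estimate with rate `f` (a consequence of `MCP(K,N)`):
`f : [0,1] → [0,1]` is continuous, `f(0) = 1`, and `m(E_{t,E×{y}}) ≥ f(t)·m(E)` for every
compact `E`, every `y` and every `t ∈ [0,1]`. -/
def EvolutionEstimate {X : Type*} [MetricSpace X] [MeasurableSpace X]
    (m : Measure X) (f : ℝ → ℝ) : Prop :=
  ContinuousOn f (Set.Icc 0 1) ∧ f 0 = 1 ∧
    (∀ t ∈ Set.Icc (0:ℝ) 1, f t ∈ Set.Icc (0:ℝ) 1) ∧
    ∀ E : Set X, IsCompact E → ∀ y : X, ∀ t ∈ Set.Icc (0:ℝ) 1,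
      ENNReal.ofReal (f t) * m E ≤ m (evoSet E (E ×ˢ ({y} : Set X)) t)

/-- The contact set `Γ = {(x,y) ∈ K × K : φ(x) + φᶜ(y) = c(x,y)}`. -/
def contactSet {X : Type*} [MetricSpace X] (h : ℝ → ℝ) (φ φc : X → ℝ) (K : Set X) :
    Set (X × X) :=
  {p | p.1 ∈ K ∧ p.2 ∈ K ∧ φ p.1 + φc p.2 = h (dist p.1 p.2)}

/-- `π` is a coupling of `(μ₀, μ₁)`: a probability measure on `X × X` with marginals
`μ₀` and `μ₁`. -/
def IsCoupling {X : Type*} [MeasurableSpace X] (π : Measure (X × X))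
    (μ₀ μ₁ : Measure X) : Prop :=
  IsProbabilityMeasure π ∧ π.map Prod.fst = μ₀ ∧ π.map Prod.snd = μ₁

/-- `Γ_E = Γ ∩ (E × X)` where `E` is the set of `x` whose fiber `({x} × X) ∩ Γ` is
not a singleton. -/
def branchSet {X : Type*} (Γ : Set (X × X)) : Set (X × X) :=
  {p ∈ Γ | ∃ w, w ≠ p.2 ∧ (p.1, w) ∈ Γ}

open Filter Topology

/-- The set of `t`-intermediate points of the pairs in `Λ`. -/
def interpSet {X : Type*} [MetricSpace X] (t : ℝ) (Λ : Set (X × X)) : Set X :=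
  {z | ∃ p ∈ Λ, dist p.1 z = t * dist p.1 p.2 ∧ dist z p.2 = (1 - t) * dist p.1 p.2}

/-- The pairs in `A × B` whose duality gap is at most `ε`. -/
def nearContactSet {X : Type*} [MetricSpace X] (h : ℝ → ℝ) (φ φc : X → ℝ) (A B : Set X)
    (ε : ℝ) : Set (X × X) :=
  {p ∈ A ×ˢ B | h (dist p.1 p.2) ≤ φ p.1 + φc p.2 + ε}

section Geodesics

variable {X : Type*} [MetricSpace X]

theorem isGeodesic_of_dist_le {γ : ℝ → X}
    (hγ : ∀ s ∈ Icc (0:ℝ) 1, ∀ u ∈ Icc (0:ℝ) 1, s ≤ u →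
      dist (γ s) (γ u) ≤ (u - s) * dist (γ 0) (γ 1)) : IsGeodesic γ := by
  have key : ∀ s ∈ Icc (0:ℝ) 1, ∀ u ∈ Icc (0:ℝ) 1, s ≤ u →
      dist (γ s) (γ u) = (u - s) * dist (γ 0) (γ 1) := by
    intro s hs u hu hsu
    refine le_antisymm (hγ s hs u hu hsu) ?_
    have h1 := hγ 0 (by simp) s hs hs.1
    have h2 := hγ u hu 1 (by simp) hu.2
    have h3 := dist_triangle4 (γ 0) (γ s) (γ u) (γ 1)
    nlinarith
  intro s hs u hu
  rcases le_total s u with hsu | hsu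
  · rw [key s hs u hu hsu, abs_sub_comm, abs_of_nonneg (sub_nonneg.2 hsu)]
  · rw [dist_comm, key u hu s hs hsu, abs_of_nonneg (sub_nonneg.2 hsu)]

theorem isGeodesic_concat {α β : ℝ → X} (hα : IsGeodesic α) (hβ : IsGeodesic β)
    (hαβ : α 1 = β 0) {t : ℝ} (ht : t ∈ Ioo (0:ℝ) 1)
    (h₁ : dist (α 0) (α 1) = t * dist (α 0) (β 1))
    (h₂ : dist (β 0) (β 1) = (1 - t) * dist (α 0) (β 1)) :
    IsGeodesic (fun s => if s ≤ t then α (s / t) else β ((s - t) / (1 - t))) := by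
  obtain ⟨ht0, ht1⟩ := ht
  have ht1' : 0 < 1 - t := by linarith
  have hl : ∀ s ∈ Icc (0:ℝ) t, s / t ∈ Icc (0:ℝ) 1 := fun s hs =>
    ⟨div_nonneg hs.1 ht0.le, (div_le_one ht0).2 hs.2⟩
  have hr : ∀ s ∈ Icc t 1, (s - t) / (1 - t) ∈ Icc (0:ℝ) 1 := fun s hs =>
    ⟨div_nonneg (by linarith [hs.1]) ht1'.le, (div_le_one ht1').2 (by linarith [hs.2])⟩
  have dl : ∀ s ∈ Icc (0:ℝ) t, ∀ u ∈ Icc (0:ℝ) t, s ≤ u →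
      dist (α (s / t)) (α (u / t)) = (u - s) * dist (α 0) (β 1) := by
    intro s hs u hu hsu
    rw [hα _ (hl s hs) _ (hl u hu), h₁, ← sub_div, abs_div, abs_of_pos ht0, abs_sub_comm,
      abs_of_nonneg (sub_nonneg.2 hsu)]
    field_simp
  have dr : ∀ s ∈ Icc t 1, ∀ u ∈ Icc t 1, s ≤ u →
      dist (β ((s - t) / (1 - t))) (β ((u - t) / (1 - t))) = (u - s) * dist (α 0) (β 1) := by
    intro s hs u hu hsu
    rw [hβ _ (hr s hs) _ (hr u hu), h₂, ← sub_div, abs_div, abs_of_pos ht1', abs_sub_comm,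
      abs_of_nonneg (by linarith)]
    field_simp
    ring
  apply isGeodesic_of_dist_le
  intro s hs u hu hsu
  have e0 : (if (0:ℝ) ≤ t then α (0 / t) else β ((0 - t) / (1 - t))) = α 0 := by
    simp [ht0.le]
  have e1 : (if (1:ℝ) ≤ t then α (1 / t) else β ((1 - t) / (1 - t))) = β 1 := by
    rw [if_neg (not_le.2 ht1), div_self ht1'.ne']
  simp only [e0, e1]
  split_ifs with hst hut hut
  · exact (dl s ⟨hs.1, hst⟩ u ⟨hu.1, hut⟩ hsu).le
  · have a1 := dl s ⟨hs.1, hst⟩ t ⟨ht0.le, le_rfl⟩ hst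
    have a2 := dr t ⟨le_rfl, ht1.le⟩ u ⟨(not_le.1 hut).le, hu.2⟩ (not_le.1 hut).le
    rw [div_self ht0.ne', hαβ] at a1
    rw [sub_self, zero_div] at a2
    have := dist_triangle (α (s / t)) (β 0) (β ((u - t) / (1 - t)))
    nlinarith
  · exact absurd (hsu.trans hut) hst
  · exact (dr s ⟨(not_le.1 hst).le, hs.2⟩ u ⟨(not_le.1 hut).le, hu.2⟩ hsu).le

theorem eq_of_common_interpolant (hgeo : GeodesicMetricSpace X) (hnb : NonBranching X)
    {t : ℝ} (ht : t ∈ Ioo (0:ℝ) 1) {x z y y' : X}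
    (hxz : dist x z = t * dist x y) (hzy : dist z y = (1 - t) * dist x y)
    (hyy' : dist x y' = dist x y) (hzy' : dist z y' = (1 - t) * dist x y) : y = y' := by
  obtain ⟨α, hα, rfl, hα1⟩ := hgeo x z
  obtain ⟨β, hβ, hβ0, rfl⟩ := hgeo z y
  obtain ⟨β', hβ', hβ'0, rfl⟩ := hgeo z y'
  have h := hnb _ _
    (isGeodesic_concat hα hβ (hα1.trans hβ0.symm) ht (by rw [hα1, hxz]) (by rw [hβ0, hzy]))
    (isGeodesic_concat hα hβ' (hα1.trans hβ'0.symm) ht (by rw [hα1, hxz, hyy'])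
      (by rw [hβ'0, hzy', hyy'])) t ht (fun s hs => by simp [hs.2]) 1 (by simp)
  have ht1' : 1 - t ≠ 0 := by linarith [ht.2]
  simpa [not_le.2 ht.2, div_self ht1'] using h

theorem StrictConvexOn.strictMonoOn_of_monotoneOn {h : ℝ → ℝ} {s : Set ℝ}
    (hconv : StrictConvexOn ℝ s h) (hmono : MonotoneOn h s) : StrictMonoOn h s := by
  intro u hu v hv huv
  have h1 := hconv.2 hu hv huv.ne (by norm_num : (0:ℝ) < 1 / 2) (by norm_num : (0:ℝ) < 1 / 2)
    (by norm_num)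
  have hm := hconv.1 hu hv (by norm_num : (0:ℝ) ≤ 1 / 2) (by norm_num : (0:ℝ) ≤ 1 / 2)
    (by norm_num)
  simp only [smul_eq_mul] at h1 hm
  have h2 := hmono hu hm (by linarith)
  linarith

/-- Two pairs that are jointly optimal for the cost `h ∘ dist` and share a `t`-intermediate
point have the same target. -/
theorem snd_eq_of_interpolants_eq (hgeo : GeodesicMetricSpace X) (hnb : NonBranching X)
    {h : ℝ → ℝ} (hconv : StrictConvexOn ℝ (Ici (0:ℝ)) h) (hmono : MonotoneOn h (Ici (0:ℝ)))
    {t : ℝ} (ht : t ∈ Ioo (0:ℝ) 1) {p q : X × X} {z : X}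
    (hp₁ : dist p.1 z = t * dist p.1 p.2) (hp₂ : dist z p.2 = (1 - t) * dist p.1 p.2)
    (hq₁ : dist q.1 z = t * dist q.1 q.2) (hq₂ : dist z q.2 = (1 - t) * dist q.1 q.2)
    (hopt : h (dist p.1 p.2) + h (dist q.1 q.2) ≤ h (dist p.1 q.2) + h (dist q.1 p.2)) :
    p.2 = q.2 := by
  have hstrict := hconv.strictMonoOn_of_monotoneOn hmono
  obtain ⟨ht0, ht1⟩ := id ht
  have hpn : (0:ℝ) ≤ dist p.1 p.2 := dist_nonneg
  have hqn : (0:ℝ) ≤ dist q.1 q.2 := dist_nonneg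
  have d1 : dist p.1 q.2 ≤ t * dist p.1 p.2 + (1 - t) * dist q.1 q.2 :=
    (dist_triangle _ z _).trans (by rw [hp₁, hq₂])
  have d2 : dist q.1 p.2 ≤ t * dist q.1 q.2 + (1 - t) * dist p.1 p.2 :=
    (dist_triangle _ z _).trans (by rw [hq₁, hp₂])
  have m1 := hmono (mem_Ici.2 dist_nonneg) (mem_Ici.2 (dist_nonneg.trans d1)) d1
  have m2 := hmono (mem_Ici.2 dist_nonneg) (mem_Ici.2 (dist_nonneg.trans d2)) d2
  have hd : dist q.1 q.2 = dist p.1 p.2 := by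
    by_contra hne
    have c1 := hconv.2 (mem_Ici.2 hpn) (mem_Ici.2 hqn) (Ne.symm hne) ht0 (sub_pos.2 ht1) (by ring)
    have c2 := hconv.2 (mem_Ici.2 hqn) (mem_Ici.2 hpn) hne ht0 (sub_pos.2 ht1) (by ring)
    simp only [smul_eq_mul] at c1 c2
    linarith
  rw [hd] at hq₂ d1 d2 hopt
  have e1 : dist p.1 q.2 = dist p.1 p.2 := by
    by_contra hne
    have l1 : dist p.1 q.2 < dist p.1 p.2 := lt_of_le_of_ne (by linarith) hne
    have s1 := hstrict (mem_Ici.2 dist_nonneg) (mem_Ici.2 hpn) l1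
    have s2 := hmono (mem_Ici.2 dist_nonneg) (mem_Ici.2 hpn)
      (show dist q.1 p.2 ≤ dist p.1 p.2 by linarith)
    linarith
  exact eq_of_common_interpolant hgeo hnb ht hp₁ hp₂ e1 hq₂

end Geodesics

section Interpolation

variable {X : Type*} [MetricSpace X]

theorem evoSet_subset_interpSet {A : Set X} {Λ : Set (X × X)} {t : ℝ} (ht : t ∈ Icc (0:ℝ) 1) :
    evoSet A Λ t ⊆ interpSet t Λ := by
  rintro _ ⟨γ, hγ, -, hΛ, rfl⟩
  refine ⟨_, hΛ, ?_, ?_⟩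
  · rw [hγ 0 (by simp) t ht, zero_sub, abs_neg, abs_of_nonneg ht.1]
  · rw [hγ t ht 1 (by simp), abs_sub_comm, abs_of_nonneg (sub_nonneg.2 ht.2)]

theorem interpSet_mono {t : ℝ} {Λ Λ' : Set (X × X)} (hΛ : Λ ⊆ Λ') :
    interpSet t Λ ⊆ interpSet t Λ' :=
  fun _ ⟨p, hp, hz⟩ => ⟨p, hΛ hp, hz⟩

theorem isCompact_interpSet [ProperSpace X] {t : ℝ} (ht : t ∈ Icc (0:ℝ) 1) {Λ : Set (X × X)}
    (hΛ : IsCompact Λ) : IsCompact (interpSet t Λ) := by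
  have hP := hΛ.image continuous_fst
  obtain ⟨D, hD⟩ := (hΛ.image (continuous_dist)).bddAbove
  have hK : IsCompact (cthickening D (Prod.fst '' Λ)) := hP.cthickening
  have hW : IsCompact ((Λ ×ˢ cthickening D (Prod.fst '' Λ)) ∩
      {w : (X × X) × X | dist w.1.1 w.2 = t * dist w.1.1 w.1.2 ∧
        dist w.2 w.1.2 = (1 - t) * dist w.1.1 w.1.2}) := by
    refine (hΛ.prod hK).inter_right (IsClosed.inter ?_ ?_) <;>
    exact isClosed_eq (by fun_prop) (by fun_prop)
  convert hW.image continuous_snd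
  ext z
  constructor
  · rintro ⟨p, hp, hz⟩
    refine ⟨(p, z), ⟨⟨hp, ?_⟩, hz⟩, rfl⟩
    refine mem_cthickening_of_dist_le z p.1 D _ (mem_image_of_mem _ hp) ?_
    rw [dist_comm, hz.1]
    have := hD (mem_image_of_mem _ hp)
    have h0 : 0 ≤ dist p.1 p.2 := dist_nonneg
    nlinarith [ht.2]
  · rintro ⟨⟨p, z'⟩, ⟨⟨hp, -⟩, hz⟩, rfl⟩
    exact ⟨p, hp, hz⟩

theorem iInter_interpSet_subset {t : ℝ} {Λ : ℕ → Set (X × X)} (hanti : ∀ n, Λ (n + 1) ⊆ Λ n)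
    (hcomp : ∀ n, IsCompact (Λ n)) : ⋂ n, interpSet t (Λ n) ⊆ interpSet t (⋂ n, Λ n) := by
  intro z hz
  have hcl : IsClosed {p : X × X | dist p.1 z = t * dist p.1 p.2 ∧
      dist z p.2 = (1 - t) * dist p.1 p.2} := by
    refine IsClosed.inter ?_ ?_ <;> exact isClosed_eq (by fun_prop) (by fun_prop)
  obtain ⟨p, hp⟩ := IsCompact.nonempty_iInter_of_sequence_nonempty_isCompact_isClosed
    (fun n => Λ n ∩ {p : X × X | dist p.1 z = t * dist p.1 p.2 ∧
      dist z p.2 = (1 - t) * dist p.1 p.2})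
    (fun n => inter_subset_inter_left _ (hanti n))
    (fun n => by
      obtain ⟨p, hp, h⟩ := mem_iInter.1 hz n
      exact ⟨p, hp, h⟩)
    ((hcomp 0).inter_right hcl) (fun n => ((hcomp n).isClosed).inter hcl)
  rw [mem_iInter] at hp
  exact ⟨p, mem_iInter.2 fun n => (hp n).1, (hp 0).2⟩

theorem continuous_comp_dist {h : ℝ → ℝ} (hconv : ConvexOn ℝ (Ici (0:ℝ)) h)
    (hmono : MonotoneOn h (Ici (0:ℝ))) : Continuous fun p : X × X => h (dist p.1 p.2) := by
  have hg : ConvexOn ℝ univ (fun x : ℝ => h (max x 0)) := by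
    refine ⟨convex_univ, fun x _ y _ a b ha hb hab => ?_⟩
    have h1 := hconv.2 (mem_Ici.2 (le_max_right x 0)) (mem_Ici.2 (le_max_right y 0)) ha hb hab
    refine le_trans (hmono (mem_Ici.2 (le_max_right _ 0)) ?_ ?_) h1
    · simp only [smul_eq_mul, mem_Ici]
      positivity
    · simp only [smul_eq_mul]
      refine max_le ?_ (by positivity)
      exact add_le_add (mul_le_mul_of_nonneg_left (le_max_left _ _) ha)
        (mul_le_mul_of_nonneg_left (le_max_left _ _) hb)
  have hc : Continuous (fun x : ℝ => h (max x 0)) :=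
    continuousOn_univ.1 (hg.continuousOn isOpen_univ)
  have := hc.comp (continuous_dist (α := X))
  simpa [Function.comp_def] using this

theorem isCompact_nearContactSet {h : ℝ → ℝ}
    (hc : Continuous fun p : X × X => h (dist p.1 p.2)) {φ φc : X → ℝ} {A B : Set X}
    (hA : IsCompact A) (hB : IsCompact B) (hφ : ContinuousOn φ A) (hφc : ContinuousOn φc B)
    (ε : ℝ) : IsCompact (nearContactSet h φ φc A B ε) := by
  have hcont : ContinuousOn (fun p : X × X => h (dist p.1 p.2) - φ p.1 - φc p.2) (A ×ˢ B) :=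
    (hc.continuousOn.sub (hφ.comp continuousOn_fst fun p hp => hp.1)).sub
      (hφc.comp continuousOn_snd fun p hp => hp.2)
  have := hcont.preimage_isClosed_of_isClosed (hA.isClosed.prod hB.isClosed)
    (isClosed_Iic (a := ε))
  convert (hA.prod hB).inter_right this using 1
  ext p
  simp only [nearContactSet, mem_ofPred_eq, mem_inter_iff, mem_preimage, mem_Iic]
  constructor
  · rintro ⟨h1, h2⟩
    exact ⟨h1, h1, by linarith⟩
  · rintro ⟨h1, -, h2⟩
    exact ⟨h1, by linarith⟩

end Interpolation

section Evolution

variable {X : Type*} [MetricSpace X] [ProperSpace X] [MeasurableSpace X] [BorelSpace X]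

theorem EvolutionEstimate.mul_measure_le_iUnion {m : Measure X} [IsFiniteMeasureOnCompacts m]
    {f : ℝ → ℝ} (hm : EvolutionEstimate m f) {t : ℝ} (ht : t ∈ Icc (0:ℝ) 1) {E : X → Set X}
    (hE : ∀ y, IsCompact (E y)) (U : Finset X)
    (hdisj : ∀ y ∈ U, ∀ y' ∈ U, y ≠ y' →
      Disjoint (interpSet t (E y ×ˢ {y})) (interpSet t (E y' ×ˢ {y'})))
    {C : Set X} (hC : IsCompact C) (hCU : C ⊆ ⋃ y ∈ U, E y) :
    ENNReal.ofReal (f t) * m C ≤ m (⋃ y ∈ U, interpSet t (E y ×ˢ {y})) := by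
  classical
  induction U using Finset.induction_on generalizing C with
  | empty =>
    have : C = ∅ := by simpa using hCU
    simp [this]
  | insert y U hy ih =>
    have hU := @ih fun a ha b hb => hdisj a (Finset.mem_insert_of_mem ha) b
      (Finset.mem_insert_of_mem hb)
    have hEy : MeasurableSet (E y) := (hE y).isClosed.measurableSet
    have h1 : ENNReal.ofReal (f t) * m (C ∩ E y) ≤ m (interpSet t (E y ×ˢ {y})) := by
      refine (hm.2.2.2 _ (hC.inter (hE y)) y t ht).trans (measure_mono ?_)
      exact (evoSet_subset_interpSet ht).trans
        (interpSet_mono (prod_mono inter_subset_right subset_rfl))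
    have h2 : ENNReal.ofReal (f t) * m (C \ E y) ≤ m (⋃ y ∈ U, interpSet t (E y ×ˢ {y})) := by
      rw [(hC.isClosed.measurableSet.diff hEy).measure_eq_iSup_isCompact_of_ne_top
        (((measure_mono sdiff_subset).trans_lt hC.measure_lt_top).ne)]
      simp only [ENNReal.mul_iSup]
      refine iSup_le fun C' => iSup_le fun hC' => iSup_le fun hcomp => hU hcomp fun x hx => ?_
      have := hCU (hC' hx).1
      rw [Finset.set_biUnion_insert] at this
      exact this.resolve_left (hC' hx).2
    have hmeas : MeasurableSet (interpSet t (E y ×ˢ {y})) :=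
      (isCompact_interpSet ht ((hE y).prod isCompact_singleton)).isClosed.measurableSet
    have hd : Disjoint (interpSet t (E y ×ˢ {y})) (⋃ y ∈ U, interpSet t (E y ×ˢ {y})) := by
      simp only [disjoint_iUnion_right]
      intro y' hy'
      exact hdisj y (Finset.mem_insert_self _ _) y' (Finset.mem_insert_of_mem hy')
        (by rintro rfl; exact hy hy')
    rw [Finset.set_biUnion_insert, measure_union' hd hmeas, ← measure_inter_add_sdiff C hEy, mul_add]
    exact add_le_add h1 h2

theorem EvolutionEstimate.mul_measure_le_nearContactSet
    (hgeo : GeodesicMetricSpace X) (hnb : NonBranching X)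
    {m : Measure X} [IsFiniteMeasureOnCompacts m] {f : ℝ → ℝ} (hm : EvolutionEstimate m f)
    {h : ℝ → ℝ} (hconv : StrictConvexOn ℝ (Ici (0:ℝ)) h) (hmono : MonotoneOn h (Ici (0:ℝ)))
    {A B : Set X} (hA : IsCompact A) (hB : IsCompact B) {φ φc : X → ℝ}
    (hφc : ContinuousOn φc B)
    (hAB : ∀ x ∈ A, ∃ y ∈ B, φ x + φc y = h (dist x y))
    {t : ℝ} (ht : t ∈ Ioo (0:ℝ) 1) {ε : ℝ} (hε : 0 < ε) :
    ENNReal.ofReal (f t) * m A ≤ m (interpSet t (nearContactSet h φ φc A B ε)) := by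
  have ht' : t ∈ Icc (0:ℝ) 1 := Ioo_subset_Icc_self ht
  have hc : Continuous fun p : X × X => h (dist p.1 p.2) :=
    continuous_comp_dist hconv.convexOn hmono
  have hcont : ContinuousOn (fun p : X × X => h (dist p.1 p.2) - φc p.2) (A ×ˢ B) :=
    hc.continuousOn.sub (hφc.comp continuousOn_snd fun p hp => hp.2)
  obtain ⟨η, hη, hunif⟩ := Metric.uniformContinuousOn_iff.1
    ((hA.prod hB).uniformContinuousOn_of_continuous hcont) ε hε
  obtain ⟨S, hSB, hSfin, hBS⟩ := hB.finite_cover_balls hη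
  lift S to Finset X using hSfin
  set E : X → Set X := fun y =>
    A ∩ {x | ∀ y' ∈ S, h (dist x y) - φc y ≤ h (dist x y') - φc y'} with hEdef
  have hE : ∀ y, IsCompact (E y) := by
    intro y
    refine hA.inter_right ?_
    simp only [ofPred_forall]
    refine isClosed_biInter fun y' _ => isClosed_le ?_ ?_
    · exact (hc.comp (Continuous.prodMk_left y)).sub continuous_const
    · exact (hc.comp (Continuous.prodMk_left y')).sub continuous_const
  have hdisj : ∀ y ∈ S, ∀ y' ∈ S, y ≠ y' →
      Disjoint (interpSet t (E y ×ˢ {y})) (interpSet t (E y' ×ˢ {y'})) := by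
    intro y hy y' hy' hne
    rw [Set.disjoint_left]
    rintro z ⟨⟨x, _⟩, ⟨hx, rfl⟩, hz₁, hz₂⟩ ⟨⟨x', _⟩, ⟨hx', rfl⟩, hz₁', hz₂'⟩
    refine hne (snd_eq_of_interpolants_eq hgeo hnb hconv hmono ht hz₁ hz₂ hz₁' hz₂' ?_)
    have a1 := hx.2 _ hy'
    have a2 := hx'.2 _ hy
    dsimp only at a1 a2 ⊢
    linarith
  have hcover : A ⊆ ⋃ y ∈ S, E y := by
    intro x hx
    have hne : S.Nonempty := by
      obtain ⟨y, hy, -⟩ := hAB x hx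
      obtain ⟨s, hs, -⟩ := mem_iUnion₂.1 (hBS hy)
      exact ⟨s, hs⟩
    obtain ⟨y, hy, hmin⟩ := S.exists_min_image (fun y => h (dist x y) - φc y) hne
    exact mem_iUnion₂.2 ⟨y, hy, hx, hmin⟩
  refine (hm.mul_measure_le_iUnion ht' hE S hdisj hA hcover).trans (measure_mono ?_)
  refine iUnion₂_subset fun y hy => interpSet_mono ?_
  rintro ⟨x, _⟩ ⟨hx, rfl⟩
  obtain ⟨w, hw, hxw⟩ := hAB x hx.1
  obtain ⟨s, hs, hws⟩ := mem_iUnion₂.1 (hBS hw)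
  have a1 := hx.2 s hs
  have a2 := hunif (x, w) ⟨hx.1, hw⟩ (x, s) ⟨hx.1, hSB hs⟩ (by simpa [Prod.dist_eq] using hws)
  rw [Real.dist_eq, abs_lt] at a2
  refine ⟨⟨hx.1, hSB hy⟩, ?_⟩
  dsimp only at a1 a2 ⊢
  linarith [a2.1]

theorem EvolutionEstimate.mul_measure_le_contactSet
    (hgeo : GeodesicMetricSpace X) (hnb : NonBranching X)
    {m : Measure X} [IsFiniteMeasureOnCompacts m] {f : ℝ → ℝ} (hm : EvolutionEstimate m f)
    {h : ℝ → ℝ} (hconv : StrictConvexOn ℝ (Ici (0:ℝ)) h) (hmono : MonotoneOn h (Ici (0:ℝ)))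
    {A B : Set X} (hA : IsCompact A) (hB : IsCompact B) {φ φc : X → ℝ}
    (hφ : ContinuousOn φ A) (hφc : ContinuousOn φc B)
    (hAB : ∀ x ∈ A, ∃ y ∈ B, φ x + φc y = h (dist x y)) {t : ℝ} (ht : t ∈ Ioo (0:ℝ) 1) :
    ENNReal.ofReal (f t) * m A ≤ m (interpSet t (nearContactSet h φ φc A B 0)) := by
  have ht' : t ∈ Icc (0:ℝ) 1 := Ioo_subset_Icc_self ht
  have hc : Continuous fun p : X × X => h (dist p.1 p.2) :=
    continuous_comp_dist hconv.convexOn hmono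
  set Λ : ℕ → Set (X × X) := fun n => nearContactSet h φ φc A B (1 / ((n : ℝ) + 1))
  have hcomp : ∀ n, IsCompact (Λ n) := fun n => isCompact_nearContactSet hc hA hB hφ hφc _
  have hanti : Antitone Λ := fun n k hnk p hp =>
    ⟨hp.1, hp.2.trans (by gcongr)⟩
  have hint : ∀ n, IsCompact (interpSet t (Λ n)) := fun n => isCompact_interpSet ht' (hcomp n)
  have hsub : ⋂ n, interpSet t (Λ n) ⊆ interpSet t (nearContactSet h φ φc A B 0) := by
    refine (iInter_interpSet_subset (fun n => hanti n.le_succ) hcomp).trans (interpSet_mono ?_)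
    intro p hp
    rw [mem_iInter] at hp
    refine ⟨(hp 0).1, ?_⟩
    refine le_of_forall_pos_le_add fun ε hε => ?_
    obtain ⟨n, hn⟩ := exists_nat_one_div_lt hε
    have := (hp n).2
    linarith
  refine le_trans ?_ (measure_mono hsub)
  rw [Antitone.measure_iInter (fun n k hnk => interpSet_mono (hanti hnk))
    (fun n => (hint n).isClosed.measurableSet.nullMeasurableSet) ⟨0, (hint 0).measure_lt_top.ne⟩]
  exact le_iInf fun n => hm.mul_measure_le_nearContactSet hgeo hnb hconv hmono hA hB hφc hAB ht
    (by positivity)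

/-- The set of points that are optimally coupled to two disjoint compact sets is null. -/
theorem EvolutionEstimate.measure_eq_zero_of_disjoint
    (hgeo : GeodesicMetricSpace X) (hnb : NonBranching X)
    {m : Measure X} [IsFiniteMeasureOnCompacts m] {f : ℝ → ℝ} (hm : EvolutionEstimate m f)
    {h : ℝ → ℝ} (hconv : StrictConvexOn ℝ (Ici (0:ℝ)) h) (hmono : MonotoneOn h (Ici (0:ℝ)))
    {A B B' : Set X} (hA : IsCompact A) (hB : IsCompact B) (hB' : IsCompact B')
    (hBB' : Disjoint B B') {φ φc : X → ℝ}
    (hφ : ContinuousOn φ A) (hφc : ContinuousOn φc B) (hφc' : ContinuousOn φc B')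
    (hpot : ∀ x ∈ A, ∀ y ∈ B ∪ B', φ x + φc y ≤ h (dist x y))
    (hAB : ∀ x ∈ A, ∃ y ∈ B, φ x + φc y = h (dist x y))
    (hAB' : ∀ x ∈ A, ∃ y ∈ B', φ x + φc y = h (dist x y)) : m A = 0 := by
  have hc : Continuous fun p : X × X => h (dist p.1 p.2) :=
    continuous_comp_dist hconv.convexOn hmono
  obtain ⟨D, hD⟩ := ((hA.prod (hB.union hB')).image continuous_dist).bddAbove
  have hthick : ∀ t ∈ Icc (0:ℝ) 1, ∀ C ⊆ B ∪ B',
      interpSet t (nearContactSet h φ φc A C 0) ⊆ cthickening (t * D) A := by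
    rintro t ht C hC z ⟨p, hp, hz, -⟩
    refine mem_cthickening_of_dist_le z p.1 _ _ hp.1.1 ?_
    rw [dist_comm, hz]
    exact mul_le_mul_of_nonneg_left (hD (mem_image_of_mem _ ⟨hp.1.1, hC hp.1.2⟩)) ht.1
  have hbound : ∀ t ∈ Ioo (0:ℝ) 1,
      ENNReal.ofReal (f t) * m A + ENNReal.ofReal (f t) * m A ≤ m (cthickening (t * D) A) := by
    intro t ht
    have ht' : t ∈ Icc (0:ℝ) 1 := Ioo_subset_Icc_self ht
    have hd : Disjoint (interpSet t (nearContactSet h φ φc A B 0))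
        (interpSet t (nearContactSet h φ φc A B' 0)) := by
      rw [Set.disjoint_left]
      rintro z ⟨p, hp, hz₁, hz₂⟩ ⟨q, hq, hz₁', hz₂'⟩
      refine Set.disjoint_left.1 hBB' hp.1.2 ?_
      rw [snd_eq_of_interpolants_eq hgeo hnb hconv hmono ht hz₁ hz₂ hz₁' hz₂' ?_]
      · exact hq.1.2
      · linarith [hp.2, hq.2, hpot _ hp.1.1 _ (Or.inr hq.1.2), hpot _ hq.1.1 _ (Or.inl hp.1.2)]
    calc
      _ ≤ m (interpSet t (nearContactSet h φ φc A B 0)) +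
          m (interpSet t (nearContactSet h φ φc A B' 0)) :=
        add_le_add (hm.mul_measure_le_contactSet hgeo hnb hconv hmono hA hB hφ hφc hAB ht)
          (hm.mul_measure_le_contactSet hgeo hnb hconv hmono hA hB' hφ hφc' hAB' ht)
      _ = m (interpSet t (nearContactSet h φ φc A B 0) ∪
          interpSet t (nearContactSet h φ φc A B' 0)) :=
        (measure_union' hd (isCompact_interpSet ht'
          (isCompact_nearContactSet hc hA hB hφ hφc 0)).isClosed.measurableSet).symm
      _ ≤ _ := measure_mono (union_subset (hthick t ht' B subset_union_left)
          (hthick t ht' B' subset_union_right))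
  have hlim0 : Tendsto (fun t : ℝ => t) (𝓝[>] 0) (𝓝 0) := tendsto_nhdsWithin_of_tendsto_nhds
    tendsto_id
  have hlimD : Tendsto (fun t : ℝ => m (cthickening (t * D) A)) (𝓝[>] 0) (𝓝 (m A)) := by
    refine (tendsto_measure_cthickening_of_isCompact hA).comp ?_
    simpa using hlim0.mul_const D
  have hlimf : Tendsto f (𝓝[>] 0) (𝓝 1) := by
    have := hm.1 0 (by simp)
    rw [ContinuousWithinAt, hm.2.1] at this
    refine this.mono_left (nhdsWithin_le_of_mem ?_)
    filter_upwards [Ioo_mem_nhdsGT (zero_lt_one (α := ℝ))] with t ht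
    exact Ioo_subset_Icc_self ht
  have hlimm : Tendsto (fun t => ENNReal.ofReal (f t) * m A) (𝓝[>] 0) (𝓝 (m A)) := by
    simpa using ENNReal.Tendsto.mul_const (b := m A) (ENNReal.tendsto_ofReal hlimf) (by simp)
  have hle : m A + m A ≤ m A + 0 := by
    rw [add_zero]
    refine le_of_tendsto_of_tendsto (hlimm.add hlimm) hlimD ?_
    filter_upwards [Ioo_mem_nhdsGT (zero_lt_one (α := ℝ))] with t ht using hbound t ht
  exact le_antisymm ((ENNReal.add_le_add_iff_left hA.measure_lt_top.ne).1 hle) (zero_le)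

end Evolution

section Selection

variable {X : Type*} [MetricSpace X] [MeasurableSpace X] [BorelSpace X]

/-- A compact relation restricted to a measurable set on which it is single-valued is contained
in the graph of a measurable map. -/
theorem IsCompact.exists_measurable_forall_eq [Nonempty X] {Γ : Set (X × X)} (hΓ : IsCompact Γ)
    {N : Set X} (hN : MeasurableSet N)
    (huniq : ∀ p ∈ Γ, ∀ q ∈ Γ, p.1 ∉ N → p.1 = q.1 → p.2 = q.2) :
    ∃ T : X → X, Measurable T ∧ ∀ p ∈ Γ, p.1 ∉ N → p.2 = T p.1 := by
  classical
  obtain ⟨x₀⟩ := ‹Nonempty X›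
  have hex : ∀ x, ∃ y, (x ∈ Prod.fst '' Γ \ N → (x, y) ∈ Γ) ∧
      (x ∉ Prod.fst '' Γ \ N → y = x₀) := by
    intro x
    by_cases hx : x ∈ Prod.fst '' Γ \ N
    · obtain ⟨⟨⟨x, y⟩, hp, rfl⟩, -⟩ := id hx
      exact ⟨y, fun _ => hp, fun h => absurd hx h⟩
    · exact ⟨x₀, fun h => absurd h hx, fun _ => rfl⟩
  choose T hT hT₀ using hex
  have hproj : ∀ C : Set X, IsClosed C → MeasurableSet (Prod.fst '' (Γ ∩ Prod.snd ⁻¹' C)) :=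
    fun C hC => ((hΓ.inter_right (hC.preimage continuous_snd)).image
      continuous_fst).isClosed.measurableSet
  have hG : MeasurableSet (Prod.fst '' Γ \ N) :=
    (hΓ.image continuous_fst).isClosed.measurableSet.diff hN
  refine ⟨T, measurable_of_isClosed fun C hC => ?_, fun p hp hpN => ?_⟩
  · have : T ⁻¹' C = (Prod.fst '' Γ \ N) ∩ Prod.fst '' (Γ ∩ Prod.snd ⁻¹' C) ∪
        (Prod.fst '' Γ \ N)ᶜ ∩ {_x | x₀ ∈ C} := by
      ext x
      by_cases hx : x ∈ Prod.fst '' Γ \ N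
      · simp only [mem_union, mem_inter_iff, hx, true_and, mem_compl_iff, not_true, false_and,
          or_false, mem_preimage]
        constructor
        · exact fun h => ⟨(x, T x), ⟨hT x hx, h⟩, rfl⟩
        · rintro ⟨q, ⟨hq, hqC⟩, hqx⟩
          have hTq : T x = q.2 := huniq (x, T x) (hT x hx) q hq hx.2 hqx.symm
          exact hTq ▸ hqC
      · simp only [mem_union, mem_inter_iff, hx, false_and, mem_compl_iff, not_false_iff, true_and,
          false_or, mem_preimage, hT₀ x hx, mem_ofPred_eq]
    rw [this]
    exact (hG.inter (hproj C hC)).union (hG.compl.inter (MeasurableSet.const _))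
  · exact huniq p hp (p.1, T p.1) (hT _ ⟨mem_image_of_mem _ hp, hpN⟩) hpN rfl

end Selection

theorem optimal_coupling_induced_by_map
    {X : Type*} [MetricSpace X] [ProperSpace X] [CompleteSpace X]
    [TopologicalSpace.SeparableSpace X] [MeasurableSpace X] [BorelSpace X]
    (hgeo : GeodesicMetricSpace X) (hnb : NonBranching X)
    (m : Measure X) [IsFiniteMeasureOnCompacts m]
    (f : ℝ → ℝ) (hm : EvolutionEstimate m f)
    (h : ℝ → ℝ) (hconv : StrictConvexOn ℝ (Set.Ici (0:ℝ)) h)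
    (hmono : MonotoneOn h (Set.Ici (0:ℝ))) (hpos : ∀ x ∈ Set.Ici (0:ℝ), 0 ≤ h x)
    (K : Set X) (hK : IsCompact K)
    (hdoub : ∃ C : ENNReal, ∀ x ∈ K, ∀ r : ℝ, 0 < r →
      (m.restrict K) (Metric.closedBall x (2 * r)) ≤ C * (m.restrict K) (Metric.closedBall x r))
    (φ φc : X → ℝ) (hφ : ContinuousOn φ K) (hφc : ContinuousOn φc K)
    (hpot : ∀ x ∈ K, ∀ y ∈ K, φ x + φc y ≤ h (dist x y))
    (μ₀ μ₁ : Measure X) [IsProbabilityMeasure μ₀] [IsProbabilityMeasure μ₁]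
    (hsupp₀ : μ₀ Kᶜ = 0) (hsupp₁ : μ₁ Kᶜ = 0) (hac : μ₀ ≪ m)
    (π : Measure (X × X)) (hπ : IsCoupling π μ₀ μ₁)
    (hπΓ : π (contactSet h φ φc K) = 1) :
    ∃ T : X → X, AEMeasurable T m ∧ π {p : X × X | p.2 = T p.1} = 1 ∧
      π = μ₀.map (fun x => (x, T x)) := by
  have : Nonempty X := (μ₀.nonempty_of_neZero)
  have hc : Continuous fun p : X × X => h (dist p.1 p.2) :=
    continuous_comp_dist hconv.convexOn hmono
  have hΓ_eq : contactSet h φ φc K = nearContactSet h φ φc K K 0 := by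
    ext p
    constructor
    · rintro ⟨h1, h2, h3⟩
      exact ⟨⟨h1, h2⟩, by linarith⟩
    · rintro ⟨⟨h1, h2⟩, h3⟩
      exact ⟨h1, h2, le_antisymm (hpot _ h1 _ h2) (by linarith)⟩
  have hΓ : IsCompact (contactSet h φ φc K) := by
    rw [hΓ_eq]
    exact isCompact_nearContactSet hc hK hK hφ hφc 0
  let P : Set X → Set X := fun C => Prod.fst '' (contactSet h φ φc K ∩ Prod.snd ⁻¹' C)
  have hP : ∀ C, IsClosed C → IsCompact (P C) := fun C hC =>
    (hΓ.inter_right (hC.preimage continuous_snd)).image continuous_fst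
  let N : ℕ × ℕ → Set X := fun i =>
    P (closedBall (TopologicalSpace.denseSeq X i.1) (1 / ((i.2 : ℝ) + 1))) ∩
      P {y | 2 * (1 / ((i.2 : ℝ) + 1)) ≤ dist y (TopologicalSpace.denseSeq X i.1)}
  have hfar : ∀ i : ℕ × ℕ, IsClosed
      {y | 2 * (1 / ((i.2 : ℝ) + 1)) ≤ dist y (TopologicalSpace.denseSeq X i.1)} := fun i =>
    isClosed_le (by fun_prop) (by fun_prop)
  have hNc : ∀ i, IsCompact (N i) := fun i => (hP _ isClosed_closedBall).inter (hP _ (hfar i))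
  have hNK : ∀ i, N i ⊆ K := by
    rintro i _ ⟨⟨p, hp, rfl⟩, -⟩
    exact hp.1.1
  have hN0 : ∀ i, m (N i) = 0 := by
    intro i
    refine hm.measure_eq_zero_of_disjoint hgeo hnb hconv hmono (hNc i)
      (hK.inter_right (isClosed_closedBall (x := TopologicalSpace.denseSeq X i.1)
        (ε := 1 / ((i.2 : ℝ) + 1)))) (hK.inter_right (hfar i)) ?_
      (hφ.mono (hNK i)) (hφc.mono inter_subset_left) (hφc.mono inter_subset_left) ?_ ?_ ?_
    · rw [Set.disjoint_left]
      rintro y ⟨-, h1⟩ ⟨-, h2⟩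
      have h3 : (0:ℝ) < 1 / ((i.2 : ℝ) + 1) := by positivity
      rw [mem_closedBall] at h1
      rw [mem_ofPred_eq] at h2
      linarith
    · rintro x hx y (hy | hy) <;> exact hpot x (hNK i hx) y hy.1
    · rintro _ ⟨⟨p, hp, rfl⟩, -⟩
      exact ⟨p.2, ⟨hp.1.2.1, hp.2⟩, hp.1.2.2⟩
    · rintro _ ⟨-, ⟨p, hp, rfl⟩⟩
      exact ⟨p.2, ⟨hp.1.2.1, hp.2⟩, hp.1.2.2⟩
  have hNmeas : MeasurableSet (⋃ i, N i) :=
    MeasurableSet.iUnion fun i => (hNc i).isClosed.measurableSet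
  have huniq : ∀ p ∈ contactSet h φ φc K, ∀ q ∈ contactSet h φ φc K,
      p.1 ∉ ⋃ i, N i → p.1 = q.1 → p.2 = q.2 := by
    intro p hp q hq hpN hpq
    by_contra hne
    obtain ⟨k, hk⟩ := exists_nat_one_div_lt (div_pos (dist_pos.2 hne) (zero_lt_three (α := ℝ)))
    obtain ⟨j, hj⟩ := (TopologicalSpace.denseRange_denseSeq X).exists_dist_lt p.2
      (show (0:ℝ) < 1 / ((k : ℝ) + 1) by positivity)
    refine hpN (mem_iUnion.2 ⟨(j, k), ⟨p, ⟨hp, mem_closedBall.2 hj.le⟩, rfl⟩,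
      ⟨q, ⟨hq, ?_⟩, hpq.symm⟩⟩)
    have := dist_triangle_right p.2 q.2 (TopologicalSpace.denseSeq X j)
    simp only [mem_preimage, mem_ofPred_eq]
    linarith
  obtain ⟨T, hT, hTΓ⟩ := hΓ.exists_measurable_forall_eq hNmeas huniq
  obtain ⟨hprob, hfst, -⟩ := hπ
  have hae : ∀ᵐ p ∂π, p.2 = T p.1 := by
    have h1 : ∀ᵐ p ∂π, p ∈ contactSet h φ φc K :=
      (mem_ae_iff_prob_eq_one hΓ.isClosed.measurableSet).2 hπΓ
    have h2 : ∀ᵐ x ∂μ₀, x ∉ ⋃ i, N i :=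
      measure_eq_zero_iff_ae_notMem.1 (hac (measure_iUnion_null hN0))
    rw [← hfst] at h2
    filter_upwards [h1, ae_of_ae_map measurable_fst.aemeasurable h2] with p hp hpN
    exact hTΓ p hp hpN
  refine ⟨T, hT.aemeasurable, ?_, ?_⟩
  · exact (mem_ae_iff_prob_eq_one
      (measurableSet_eq_fun measurable_snd (hT.comp measurable_fst))).1 hae
  · rw [← hfst, Measure.map_map (measurable_id'.prodMk hT) measurable_fst]
    conv_lhs => rw [← Measure.map_id (μ := π)]
    refine Measure.map_congr ?_
    filter_upwards [hae] with p hp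
    exact Prod.ext rfl hp
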